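/- Let A, E ∈ ℂ^{n×n} with A Hermitian and E skew-Hermitian (so the pencil L(s) = A + sE is *-even), and assume L(s) is regular. Then the infimum of √(‖Δ_A‖² + ‖Δ_E‖²) over all pairs (Δ_A, Δ_E) with Δ_A Hermitian and Δ_E skew-Hermitian for which there exists a nonzero v ∈ ℂⁿ with (A − Δ_A)v = 0 and (E − Δ_E)v = 0 equals √(λ_min(AᴴA + EᴴE)). -/

import Mathlib

open Matrix

/-- The spectral norm (ℓ² operator norm) of a complex matrix. -/
noncomputable def specNorm {k : Type*} [Fintype k] [DecidableEq k]
    (X : Matrix k k ℂ) : ℝ :=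
  ‖Matrix.toEuclideanCLM (𝕜 := ℂ) X‖

/-- The smallest eigenvalue of a Hermitian matrix (junk value `0` otherwise). -/
noncomputable def lamMin {k : Type*} [Fintype k] [DecidableEq k]
    (H : Matrix k k ℂ) : ℝ :=
  if h : H.IsHermitian then ⨅ i, h.eigenvalues i else 0

/-- Hermitian mapping lemma: built from a scaled reflection. -/
lemma exists_selfAdjoint_map {H : Type*} [NormedAddCommGroup H] [InnerProductSpace ℂ H]
    [CompleteSpace H] (T : H →L[ℂ] H) (hT : IsSelfAdjoint T) (v : H) (hv : v ≠ 0) :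
    ∃ D : H →L[ℂ] H, IsSelfAdjoint D ∧ D v = T v ∧ ‖D‖ * ‖v‖ ≤ ‖T v‖ := by
  by_cases h0 : T v = 0
  · exact ⟨0, IsSelfAdjoint.zero _, by simp [h0], by simp⟩
  have hv' : ‖v‖ ≠ 0 := norm_ne_zero_iff.2 hv
  have hT' : ‖T v‖ ≠ 0 := norm_ne_zero_iff.2 h0
  have hsym : inner ℂ (T v) v = inner ℂ v (T v) :=
    (ContinuousLinearMap.isSelfAdjoint_iff_isSymmetric.1 hT) v v
  set c : ℝ := ‖v‖ / ‖T v‖ with hc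
  set w : H := (c : ℂ) • T v with hw
  have hwn : ‖w‖ = ‖v‖ := by
    rw [hw, norm_smul, Complex.norm_real, Real.norm_of_nonneg (by positivity), hc]
    field_simp
  have hvw : inner ℂ v w = inner ℂ w v := by
    rw [hw, inner_smul_left, inner_smul_right, hsym, Complex.conj_ofReal]
  set K : Submodule ℂ H := (ℂ ∙ (v - w))ᗮ with hK
  have h1 : K.reflection (v - w) = -(v - w) :=
    Submodule.reflection_orthogonalComplement_singleton_eq_neg (𝕜 := ℂ) (v - w)
  have h2 : K.reflection (v + w) = v + w := by
    rw [Submodule.reflection_eq_self_iff, hK, Submodule.mem_orthogonal_singleton_iff_inner_right]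
    rw [inner_sub_left, inner_add_right, inner_add_right, inner_self_eq_norm_sq_to_K,
      inner_self_eq_norm_sq_to_K, hwn, hvw]
    ring
  have h3 : K.reflection v = w := by
    rw [map_sub] at h1
    rw [map_add] at h2
    have h4 : (2 : ℂ) • K.reflection v = (2 : ℂ) • w := by
      rw [two_smul, two_smul]
      calc K.reflection v + K.reflection v
          = (K.reflection v - K.reflection w) + (K.reflection v + K.reflection w) := by abel
        _ = w + w := by rw [h1, h2]; abel
    exact smul_right_injective H (two_ne_zero (α := ℂ)) h4
  let R : H →L[ℂ] H := (K.reflection.toContinuousLinearEquiv : H →L[ℂ] H)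
  have hR : ∀ x, R x = K.reflection x := fun x => rfl
  have hRs : IsSelfAdjoint R := by
    rw [ContinuousLinearMap.isSelfAdjoint_iff_isSymmetric]
    intro x y
    change inner ℂ (K.reflection x) y = inner ℂ x (K.reflection y)
    rw [← K.reflection.inner_map_map x (K.reflection y), Submodule.reflection_reflection]
  have hRn : ‖R‖ ≤ 1 := by
    refine ContinuousLinearMap.opNorm_le_bound _ zero_le_one fun x => ?_
    rw [hR, LinearIsometryEquiv.norm_map, one_mul]
  refine ⟨((‖T v‖ / ‖v‖ : ℝ) : ℂ) • R, ?_, ?_, ?_⟩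
  · exact IsSelfAdjoint.smul (Complex.conj_ofReal _) hRs
  · rw [_root_.smul_apply, hR, h3, hw, smul_smul, ← Complex.ofReal_mul, hc]
    rw [show ‖T v‖ / ‖v‖ * (‖v‖ / ‖T v‖) = 1 by field_simp]
    simp
  · rw [norm_smul, Complex.norm_real, Real.norm_of_nonneg (by positivity)]
    calc ‖T v‖ / ‖v‖ * ‖R‖ * ‖v‖ = ‖T v‖ * ‖R‖ := by field_simp
      _ ≤ ‖T v‖ * 1 := by gcongr
      _ = _ := mul_one _

lemma exists_hermitian_map {n : ℕ} (A : Matrix (Fin n) (Fin n) ℂ) (hA : A.IsHermitian)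
    (v : Fin n → ℂ) (hv : v ≠ 0) :
    ∃ D : Matrix (Fin n) (Fin n) ℂ, D.IsHermitian ∧ D *ᵥ v = A *ᵥ v ∧
      specNorm D * ‖WithLp.toLp 2 v‖ ≤ ‖WithLp.toLp 2 (A *ᵥ v)‖ := by
  have hT : IsSelfAdjoint (Matrix.toEuclideanCLM (𝕜 := ℂ) A) := by
    rw [IsSelfAdjoint, ← map_star, Matrix.star_eq_conjTranspose, hA.eq]
  obtain ⟨D, h1, h2, h3⟩ := exists_selfAdjoint_map _ hT (WithLp.toLp 2 v) (by simpa using hv)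
  obtain ⟨M, rfl⟩ : ∃ M, Matrix.toEuclideanCLM (n := Fin n) (𝕜 := ℂ) M = D :=
    EquivLike.surjective (Matrix.toEuclideanCLM (n := Fin n) (𝕜 := ℂ)) D
  refine ⟨M, ?_, ?_, ?_⟩
  · rw [IsSelfAdjoint, ← map_star] at h1
    exact EquivLike.injective (Matrix.toEuclideanCLM (n := Fin n) (𝕜 := ℂ)) h1
  · simpa [Matrix.toEuclideanCLM_toLp] using h2
  · simpa [Matrix.toEuclideanCLM_toLp, specNorm] using h3

lemma norm_mulVec_le_specNorm {n : ℕ} (D : Matrix (Fin n) (Fin n) ℂ) (v : Fin n → ℂ) :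
    ‖WithLp.toLp 2 (D *ᵥ v)‖ ≤ specNorm D * ‖WithLp.toLp 2 v‖ := by
  have := (Matrix.toEuclideanCLM (𝕜 := ℂ) D).le_opNorm (WithLp.toLp 2 v)
  simpa [Matrix.toEuclideanCLM_toLp, specNorm] using this

lemma specNorm_smul {n : ℕ} (c : ℂ) (D : Matrix (Fin n) (Fin n) ℂ) :
    specNorm (c • D) = ‖c‖ * specNorm D := by
  rw [specNorm, map_smul, norm_smul, specNorm]

lemma isHermitian_gram {n : ℕ} (A E : Matrix (Fin n) (Fin n) ℂ) :
    (Aᴴ * A + Eᴴ * E).IsHermitian :=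
  (isHermitian_conjTranspose_mul_self A).add (isHermitian_conjTranspose_mul_self E)

lemma gram_eq {n : ℕ} (A : Matrix (Fin n) (Fin n) ℂ) (v : Fin n → ℂ) :
    star v ⬝ᵥ ((Aᴴ * A) *ᵥ v) = ((‖WithLp.toLp 2 (A *ᵥ v)‖ ^ 2 : ℝ) : ℂ) := by
  rw [← Matrix.mulVec_mulVec, Matrix.dotProduct_mulVec, ← Matrix.star_mulVec, dotProduct_comm,
    ← EuclideanSpace.inner_toLp_toLp, inner_self_eq_norm_sq_to_K]
  simp

lemma norm_sq_eq {n : ℕ} (v : Fin n → ℂ) :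
    star v ⬝ᵥ v = ((‖WithLp.toLp 2 v‖ ^ 2 : ℝ) : ℂ) := by
  simpa using gram_eq (1 : Matrix (Fin n) (Fin n) ℂ) v

lemma rayleigh {n : ℕ} (H : Matrix (Fin n) (Fin n) ℂ) (h : H.IsHermitian) (m : ℝ)
    (hm : ∀ i, m ≤ h.eigenvalues i) (v : Fin n → ℂ) :
    m * ‖WithLp.toLp 2 v‖ ^ 2 ≤ (star v ⬝ᵥ (H *ᵥ v)).re := by
  set b := h.eigenvectorBasis
  have hb : ∀ i, inner ℂ (b i) (WithLp.toLp 2 (H *ᵥ v)) =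
      (h.eigenvalues i : ℂ) * inner ℂ (b i) (WithLp.toLp 2 v) := by
    intro i
    have h1 := h.mulVec_eigenvectorBasis i
    have h2 : ∀ (x : EuclideanSpace ℂ (Fin n)) (y : Fin n → ℂ),
      inner ℂ x (WithLp.toLp 2 y) = star (x.ofLp) ⬝ᵥ y := by
      intro x y
      rw [EuclideanSpace.inner_eq_star_dotProduct, dotProduct_comm]
    rw [h2, h2, Matrix.dotProduct_mulVec]
    have h3 : star (b i).ofLp ᵥ* H = star (H *ᵥ (b i).ofLp) := by
      rw [Matrix.star_mulVec, h.eq]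
    rw [h3, h1, star_smul, smul_dotProduct]
    simp [b]
  have hs : (star v ⬝ᵥ (H *ᵥ v)).re = ∑ i, h.eigenvalues i * ‖inner ℂ (b i) (WithLp.toLp 2 v)‖ ^ 2 := by
    rw [dotProduct_comm, ← EuclideanSpace.inner_toLp_toLp, ← b.sum_inner_mul_inner, Complex.re_sum]
    refine Finset.sum_congr rfl fun i _ => ?_
    rw [hb, mul_left_comm, ← inner_conj_symm (WithLp.toLp 2 v) (b i), Complex.conj_mul']
    rw [← Complex.ofReal_pow, ← Complex.ofReal_mul, Complex.ofReal_re]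
  rw [hs, ← b.sum_sq_norm_inner_right, Finset.mul_sum]
  gcongr with i
  exact hm i

theorem starEven_distance_to_common_null_space
    {n : ℕ} (A E : Matrix (Fin n) (Fin n) ℂ)
    (hA : A.IsHermitian) (hE : Eᴴ = -E)
    (hreg : ∃ l : ℂ, (A + l • E).det ≠ 0) :
    sInf {r : ℝ | ∃ (DA DE : Matrix (Fin n) (Fin n) ℂ) (v : Fin n → ℂ),
        DA.IsHermitian ∧ DEᴴ = -DE ∧
        v ≠ 0 ∧ (A - DA).mulVec v = 0 ∧ (E - DE).mulVec v = 0 ∧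
        r = Real.sqrt (specNorm DA ^ 2 + specNorm DE ^ 2)} =
      Real.sqrt (lamMin (Aᴴ * A + Eᴴ * E)) := by
  have hH := isHermitian_gram A E
  have hlam : lamMin (Aᴴ * A + Eᴴ * E) = ⨅ i, hH.eigenvalues i := by
    rw [lamMin, dif_pos hH]
  rcases Nat.eq_zero_or_pos n with rfl | hn
  · rw [hlam, Real.iInf_of_isEmpty, Real.sqrt_zero]
    convert Real.sInf_empty
    ext r
    simp only [Set.mem_ofPred_eq, Set.mem_empty_iff_false, iff_false]
    rintro ⟨_, _, v, _, _, hv, _⟩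
    exact hv (Subsingleton.elim _ _)
  have : Nonempty (Fin n) := ⟨⟨0, hn⟩⟩
  have hsum : ∀ v : Fin n → ℂ, star v ⬝ᵥ ((Aᴴ * A + Eᴴ * E) *ᵥ v) =
      ((‖WithLp.toLp 2 (A *ᵥ v)‖ ^ 2 + ‖WithLp.toLp 2 (E *ᵥ v)‖ ^ 2 : ℝ) : ℂ) := by
    intro v
    rw [Matrix.add_mulVec, dotProduct_add, gram_eq, gram_eq]
    push_cast
    rfl
  have hlow : ∀ r ∈ {r : ℝ | ∃ (DA DE : Matrix (Fin n) (Fin n) ℂ) (v : Fin n → ℂ),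
        DA.IsHermitian ∧ DEᴴ = -DE ∧
        v ≠ 0 ∧ (A - DA).mulVec v = 0 ∧ (E - DE).mulVec v = 0 ∧
        r = Real.sqrt (specNorm DA ^ 2 + specNorm DE ^ 2)},
      Real.sqrt (lamMin (Aᴴ * A + Eᴴ * E)) ≤ r := by
    rintro r ⟨DA, DE, v, -, -, hv, h1, h2, rfl⟩
    apply Real.sqrt_le_sqrt
    rw [Matrix.sub_mulVec, sub_eq_zero] at h1 h2
    have hr := rayleigh _ hH (lamMin (Aᴴ * A + Eᴴ * E))
      (fun i => hlam ▸ ciInf_le (Set.finite_range _).bddBelow i) v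
    rw [hsum, Complex.ofReal_re, h1, h2] at hr
    have hvp : 0 < ‖WithLp.toLp 2 v‖ := norm_pos_iff.2 (by simpa using hv)
    have ha := pow_le_pow_left₀ (norm_nonneg _) (norm_mulVec_le_specNorm DA v) 2
    have he := pow_le_pow_left₀ (norm_nonneg _) (norm_mulVec_le_specNorm DE v) 2
    refine le_of_mul_le_mul_right ?_ (pow_pos hvp 2)
    calc _ ≤ _ := hr
      _ ≤ _ := add_le_add ha he
      _ = _ := by ring
  obtain ⟨i, hi⟩ := exists_eq_ciInf_of_finite (f := hH.eigenvalues)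
  set v : Fin n → ℂ := (hH.eigenvectorBasis i).ofLp with hvdef
  have hvn : ‖WithLp.toLp 2 v‖ = 1 := hH.eigenvectorBasis.orthonormal.1 i
  have hv0 : v ≠ 0 := by
    intro h
    rw [h] at hvn
    simp at hvn
  have hEv : ‖WithLp.toLp 2 (A *ᵥ v)‖ ^ 2 + ‖WithLp.toLp 2 (E *ᵥ v)‖ ^ 2 =
      lamMin (Aᴴ * A + Eᴴ * E) := by
    have h1 := hsum v
    rw [hvdef, hH.mulVec_eigenvectorBasis i, ← hvdef, hi, ← hlam, dotProduct_smul, norm_sq_eq,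
      hvn] at h1
    have h2 := congrArg Complex.re h1
    rw [Complex.ofReal_re] at h2
    rw [← h2]
    simp
  obtain ⟨DA, hDA, hDAv, hDAn⟩ := exists_hermitian_map A hA v hv0
  have hIE : (Complex.I • E).IsHermitian := by
    rw [Matrix.IsHermitian, conjTranspose_smul, hE]
    simp
  obtain ⟨D, hD, hDv, hDn⟩ := exists_hermitian_map _ hIE v hv0
  have hDEn : specNorm (-Complex.I • D) ≤ ‖WithLp.toLp 2 (E *ᵥ v)‖ := by
    rw [specNorm_smul]
    rw [hvn, mul_one, Matrix.smul_mulVec, WithLp.toLp_smul, norm_smul] at hDn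
    simpa using hDn
  rw [hvn, mul_one] at hDAn
  have hmem : Real.sqrt (specNorm DA ^ 2 + specNorm (-Complex.I • D) ^ 2) ∈
      {r : ℝ | ∃ (DA DE : Matrix (Fin n) (Fin n) ℂ) (v : Fin n → ℂ),
        DA.IsHermitian ∧ DEᴴ = -DE ∧
        v ≠ 0 ∧ (A - DA).mulVec v = 0 ∧ (E - DE).mulVec v = 0 ∧
        r = Real.sqrt (specNorm DA ^ 2 + specNorm DE ^ 2)} := by
    refine ⟨DA, -Complex.I • D, v, hDA, ?_, hv0, ?_, ?_, rfl⟩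
    · rw [conjTranspose_smul, hD.eq]
      simp
    · rw [Matrix.sub_mulVec, hDAv, sub_self]
    · rw [Matrix.sub_mulVec, Matrix.smul_mulVec, hDv, Matrix.smul_mulVec, smul_smul]
      simp
  refine le_antisymm ((csInf_le ⟨_, hlow⟩ hmem).trans ?_) (le_csInf ⟨_, hmem⟩ hlow)
  apply Real.sqrt_le_sqrt
  rw [← hEv]
  exact add_le_add (pow_le_pow_left₀ (norm_nonneg _) hDAn 2)
    (pow_le_pow_left₀ (norm_nonneg _) hDEn 2)
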